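/- Let 0 < α < 1 and r > 0. Then lim_{t→∞} |E_α(r e^{iαπ/2} t^α)| = 1/α. -/

import Mathlib

open Filter Real

/-- The two-parameter Mittag-Leffler function `E_{α,β}(z) = ∑_{k=0}^∞ z^k / Γ(αk + β)`. -/
noncomputable def mittagLeffler (α β : ℝ) (z : ℂ) : ℂ :=
  ∑' k : ℕ, z ^ k / Complex.Gamma (α * k + β)

open MeasureTheory Set Topology

theorem rpow_mul_exp_neg_le_Gamma_add_one {A s : ℝ} (hA : 0 < A) (hs : 0 ≤ s) :
    A ^ s * Real.exp (-A) ≤ Real.Gamma (s + 1) := by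
  have hint : IntegrableOn (fun x : ℝ => Real.exp (-x) * x ^ s) (Ioi 0) := by
    simpa using Real.GammaIntegral_convergent (s := s + 1) (by linarith)
  rw [Real.Gamma_eq_integral (by linarith), ← integral_exp_neg_Ioi, ← integral_const_mul]
  simp only [add_sub_cancel_right]
  calc ∫ x in Ioi A, A ^ s * Real.exp (-x)
      ≤ ∫ x in Ioi A, Real.exp (-x) * x ^ s := by
        refine setIntegral_mono_on ((integrableOn_exp_neg_Ioi A).const_mul _)
          (hint.mono_set (Ioi_subset_Ioi hA.le)) measurableSet_Ioi fun x hx => ?_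
        rw [mul_comm]
        gcongr
        exact le_of_lt hx
    _ ≤ _ := by
        refine setIntegral_mono_set hint ?_ (Ioi_subset_Ioi hA.le).eventuallyLE
        filter_upwards [ae_restrict_mem measurableSet_Ioi] with x hx
        have : (0 : ℝ) < x := hx
        simp only [Pi.zero_apply]
        positivity

theorem norm_mittagLeffler_term_le {α A : ℝ} (hα : 0 < α) (hA : 0 < A) {z : ℂ}
    (hz : ‖z‖ ≤ A ^ α / 2) (k : ℕ) :
    ‖z ^ k / Complex.Gamma (α * k + (1 : ℝ))‖ ≤ Real.exp A * (1 / 2) ^ k := by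
  have hG : Complex.Gamma (α * k + (1 : ℝ)) = (Real.Gamma (α * k + 1) : ℝ) := by
    rw [← Complex.Gamma_ofReal]; push_cast; rfl
  have hpos : 0 < Real.Gamma (α * k + 1) := Real.Gamma_pos_of_pos (by positivity)
  have h1 := rpow_mul_exp_neg_le_Gamma_add_one hA (s := α * k) (by positivity)
  rw [norm_div, norm_pow, hG, Complex.norm_real, Real.norm_of_nonneg hpos.le, div_le_iff₀ hpos]
  calc ‖z‖ ^ k ≤ (A ^ α / 2) ^ k := by gcongr
    _ = Real.exp A * (1 / 2) ^ k * (A ^ (α * k) * Real.exp (-A)) := by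
        rw [Real.rpow_mul hA.le, Real.rpow_natCast, Real.exp_neg, div_pow, one_div, inv_pow]
        field_simp
    _ ≤ _ := by gcongr

theorem norm_mittagLeffler_le {α A : ℝ} (hα : 0 < α) (hA : 0 < A) {z : ℂ}
    (hz : ‖z‖ ≤ A ^ α / 2) : ‖mittagLeffler α 1 z‖ ≤ Real.exp A * 2 :=
  tsum_of_norm_bounded (hasSum_geometric_two.mul_left _) (norm_mittagLeffler_term_le hα hA hz)

theorem continuous_mittagLeffler {α : ℝ} (hα : 0 < α) : Continuous (mittagLeffler α 1) := by
  rw [continuous_iff_continuousAt]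
  intro z
  set R := ‖z‖ + 1
  have hR : 0 < R := by positivity
  have hA : 0 < (2 * R) ^ α⁻¹ := by positivity
  have hAR : ((2 * R) ^ α⁻¹) ^ α / 2 = R := by
    rw [Real.rpow_inv_rpow (by positivity) hα.ne']; ring
  have : ContinuousOn (mittagLeffler α 1) (Metric.ball 0 R) := by
    refine continuousOn_tsum (u := fun k => Real.exp ((2 * R) ^ α⁻¹) * (1 / 2) ^ k) (fun k => ?_)
      (summable_geometric_two.mul_left _) fun k x hx => ?_
    · fun_prop
    · refine norm_mittagLeffler_term_le hα hA ?_ k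
      rw [hAR]
      exact (mem_ball_zero_iff.1 hx).le
  exact this.continuousAt (Metric.isOpen_ball.mem_nhds (by simp [R]))

theorem integrableOn_rpow_mul_exp_neg_mul_Ioi {a c : ℝ} (ha : 0 ≤ a) (hc : 0 < c) :
    IntegrableOn (fun t : ℝ => t ^ a * Real.exp (-(c * t))) (Ioi 0) := by
  simpa using integrableOn_rpow_mul_exp_neg_mul_rpow (s := a) (p := 1) (b := c)
    (by linarith) one_pos hc

theorem norm_rpow_mul_cexp_neg_mul (a : ℝ) (s : ℂ) {t : ℝ} (ht : 0 < t) :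
    ‖((t ^ a : ℝ) : ℂ) * Complex.exp (-(s * t))‖ = t ^ a * Real.exp (-(s.re * t)) := by
  rw [norm_mul, Complex.norm_real, Real.norm_of_nonneg (by positivity), Complex.norm_exp]
  simp

theorem integrableOn_rpow_mul_cexp_neg_mul_Ioi {a : ℝ} (ha : 0 ≤ a) {s : ℂ} (hs : 0 < s.re) :
    IntegrableOn (fun t : ℝ => ((t ^ a : ℝ) : ℂ) * Complex.exp (-(s * t))) (Ioi 0) := by
  refine (integrableOn_rpow_mul_exp_neg_mul_Ioi ha hs).mono' (by fun_prop) ?_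
  filter_upwards [ae_restrict_mem measurableSet_Ioi] with t ht
  exact (norm_rpow_mul_cexp_neg_mul a s ht).le

theorem differentiableAt_integral_rpow_mul_cexp_neg_mul {a : ℝ} (ha : 0 ≤ a) {s : ℂ}
    (hs : 0 < s.re) :
    DifferentiableAt ℂ
      (fun s : ℂ => ∫ t : ℝ in Ioi 0, ((t ^ a : ℝ) : ℂ) * Complex.exp (-(s * t))) s := by
  have hmem : {w : ℂ | s.re / 2 < w.re} ∈ 𝓝 s :=
    (isOpen_lt continuous_const Complex.continuous_re).mem_nhds (by simpa using half_lt_self hs)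
  refine (hasDerivAt_integral_of_dominated_loc_of_deriv_le
    (μ := volume.restrict (Ioi 0))
    (F := fun (w : ℂ) (t : ℝ) => ((t ^ a : ℝ) : ℂ) * Complex.exp (-(w * t)))
    (F' := fun (w : ℂ) (t : ℝ) => -(((t ^ (a + 1) : ℝ) : ℂ) * Complex.exp (-(w * t))))
    (bound := fun t : ℝ => t ^ (a + 1) * Real.exp (-(s.re / 2 * t))) hmem ?_
    (integrableOn_rpow_mul_cexp_neg_mul_Ioi ha hs) (by fun_prop) ?_
    (integrableOn_rpow_mul_exp_neg_mul_Ioi (by linarith) (half_pos hs)) ?_).2.differentiableAt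
  · exact Eventually.of_forall fun w => by fun_prop
  · filter_upwards [ae_restrict_mem measurableSet_Ioi] with t ht w hw
    have ht' : (0 : ℝ) < t := ht
    have hw' : s.re / 2 < w.re := hw
    rw [norm_neg, norm_rpow_mul_cexp_neg_mul _ _ ht]
    gcongr
  · filter_upwards [ae_restrict_mem measurableSet_Ioi] with t ht w hw
    have ht' : (0 : ℝ) < t := ht
    have h1 : HasDerivAt (fun w : ℂ => -(w * t)) (-(1 * (t : ℂ))) w :=
      ((hasDerivAt_id w).mul_const (t : ℂ)).neg
    convert! h1.cexp.const_mul ((t ^ a : ℝ) : ℂ) using 1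
    rw [Real.rpow_add_one ht'.ne']
    push_cast
    ring

theorem integral_rpow_mul_cexp_neg_mul_Ioi {a : ℝ} (ha : 0 ≤ a) {s : ℂ} (hs : 0 < s.re) :
    ∫ t : ℝ in Ioi 0, ((t ^ a : ℝ) : ℂ) * Complex.exp (-(s * t)) =
      s ^ (-(a + 1) : ℂ) * Real.Gamma (a + 1) := by
  have hopen : IsOpen {w : ℂ | 0 < w.re} := isOpen_lt continuous_const Complex.continuous_re
  have h1 : AnalyticOnNhd ℂ
      (fun s : ℂ => ∫ t : ℝ in Ioi 0, ((t ^ a : ℝ) : ℂ) * Complex.exp (-(s * t)))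
      {w : ℂ | 0 < w.re} :=
    DifferentiableOn.analyticOnNhd (fun w hw =>
      (differentiableAt_integral_rpow_mul_cexp_neg_mul ha hw).differentiableWithinAt) hopen
  have h2 : AnalyticOnNhd ℂ (fun s : ℂ => s ^ (-(a + 1) : ℂ) * Real.Gamma (a + 1))
      {w : ℂ | 0 < w.re} :=
    DifferentiableOn.analyticOnNhd (fun w hw =>
      ((differentiableAt_id.cpow_const (Or.inl hw)).mul_const _).differentiableWithinAt) hopen
  refine h1.eqOn_of_preconnected_of_frequently_eq h2 (convex_halfSpace_re_gt 0).isPreconnected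
    (z₀ := 1) (by simp) ?_ hs
  have htend : Tendsto (fun x : ℝ => (x : ℂ)) (𝓝[>] 1) (𝓝[≠] 1) := by
    refine tendsto_nhdsWithin_iff.2 ⟨?_, ?_⟩
    · exact (Complex.continuous_ofReal.tendsto' 1 1 (by simp)).mono_left nhdsWithin_le_nhds
    · filter_upwards [self_mem_nhdsWithin] with x hx
      simpa using (ne_of_gt hx : x ≠ 1)
  refine htend.frequently (Eventually.frequently ?_)
  filter_upwards [self_mem_nhdsWithin] with x hx
  have hx0 : 0 < x := lt_trans one_pos hx
  have h := Real.integral_rpow_mul_exp_neg_mul_Ioi (a := a + 1) (by linarith) hx0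
  rw [add_sub_cancel_right, one_div, Real.inv_rpow hx0.le, ← Real.rpow_neg hx0.le] at h
  have h' := congrArg (fun y : ℝ => (y : ℂ)) h
  rw [← integral_complex_ofReal, Complex.ofReal_mul, Complex.ofReal_cpow hx0.le] at h'
  push_cast at h' ⊢
  exact h'

theorem integral_mittagLeffler_mul_cexp_neg_mul_Ioi {α : ℝ} (hα : 0 < α) {lam : ℂ}
    (hlam : ‖lam‖ = 1) {s : ℂ} (hs : 1 < s.re) :
    ∫ t : ℝ in Ioi 0, mittagLeffler α 1 (lam * ((t ^ α : ℝ) : ℂ)) * Complex.exp (-(s * t)) =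
      s ^ (α - 1 : ℂ) / (s ^ (α : ℂ) - lam) := by
  have hs0 : 0 < s.re := by linarith
  have hsne : s ≠ 0 := Complex.ne_zero_of_re_pos hs0
  have hΓ (k : ℕ) : 0 < Real.Gamma (α * k + 1) := Real.Gamma_pos_of_pos (by positivity)
  have hΓC (k : ℕ) : Complex.Gamma (α * k + (1 : ℝ)) = (Real.Gamma (α * k + 1) : ℝ) := by
    rw [← Complex.Gamma_ofReal]; push_cast; rfl
  set F : ℕ → ℝ → ℂ := fun k t => lam ^ k / (Real.Gamma (α * k + 1) : ℝ) *
    (((t ^ (α * k) : ℝ) : ℂ) * Complex.exp (-(s * t))) with hF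
  have hFint (k : ℕ) : IntegrableOn (F k) (Ioi 0) :=
    (integrableOn_rpow_mul_cexp_neg_mul_Ioi (by positivity) hs0).const_mul _
  have hnorm (k : ℕ) : ∫ t in Ioi 0, ‖F k t‖ = s.re⁻¹ * (s.re ^ (-α)) ^ k := by
    have h := Real.integral_rpow_mul_exp_neg_mul_Ioi (a := α * k + 1) (by positivity) hs0
    rw [add_sub_cancel_right] at h
    have : ∀ t ∈ Ioi (0 : ℝ), ‖F k t‖ =
        (Real.Gamma (α * k + 1))⁻¹ * (t ^ (α * k) * Real.exp (-(s.re * t))) := by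
      intro t ht
      rw [hF]
      simp only
      rw [norm_mul, norm_rpow_mul_cexp_neg_mul _ _ ht, norm_div, norm_pow, hlam, one_pow,
        Complex.norm_real, Real.norm_of_nonneg (hΓ k).le, one_div]
    rw [setIntegral_congr_fun measurableSet_Ioi this, integral_const_mul, h, one_div,
      Real.rpow_add_one (by positivity), Real.inv_rpow hs0.le, ← Real.rpow_neg hs0.le,
      ← Real.rpow_natCast, ← Real.rpow_mul hs0.le]
    have := (hΓ k).ne'
    field_simp
  have hsum : Summable fun k => ∫ t in Ioi 0, ‖F k t‖ := by
    simp_rw [hnorm]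
    refine (summable_geometric_of_lt_one (by positivity) ?_).mul_left _
    exact Real.rpow_lt_one_of_one_lt_of_neg hs (by linarith)
  have hS := hasSum_integral_of_summable_integral_norm hFint hsum
  have hval (k : ℕ) : ∫ t in Ioi 0, F k t = s⁻¹ * (lam * s ^ (-α : ℂ)) ^ k := by
    rw [hF]
    simp only
    rw [integral_const_mul, integral_rpow_mul_cexp_neg_mul_Ioi (by positivity) hs0, mul_pow,
      ← Complex.cpow_mul_nat]
    have h1 : (-(((α * k : ℝ) : ℂ) + 1)) = -α * k + -1 := by push_cast; ring
    have h2 : (Real.Gamma (α * k + 1) : ℂ) ≠ 0 := by exact_mod_cast (hΓ k).ne'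
    rw [h1, Complex.cpow_add _ _ hsne, Complex.cpow_neg_one]
    field_simp
  have hlt : ‖lam * s ^ (-α : ℂ)‖ < 1 := by
    rw [norm_mul, hlam, one_mul, ← Complex.ofReal_neg, Complex.norm_cpow_real]
    exact Real.rpow_lt_one_of_one_lt_of_neg (hs.trans_le (Complex.re_le_norm s)) (by linarith)
  simp_rw [hval] at hS
  have hT := (hasSum_geometric_of_norm_lt_one hlt).mul_left s⁻¹
  have hEq := hS.unique hT
  have hcongr : ∀ t ∈ Ioi (0 : ℝ),
      mittagLeffler α 1 (lam * ((t ^ α : ℝ) : ℂ)) * Complex.exp (-(s * t)) = ∑' k, F k t := by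
    intro t ht
    rw [mittagLeffler, ← tsum_mul_right]
    refine tsum_congr fun k => ?_
    simp only [hF]
    rw [hΓC, Real.rpow_mul (le_of_lt ht), Real.rpow_natCast]
    push_cast
    ring
  rw [setIntegral_congr_fun measurableSet_Ioi hcongr, hEq, Complex.cpow_sub _ _ hsne,
    Complex.cpow_one, Complex.cpow_neg]
  have hsα : s ^ (α : ℂ) ≠ 0 := by simp [Complex.cpow_eq_zero_iff, hsne]
  have hne : s ^ (α : ℂ) - lam ≠ 0 := by
    intro h
    rw [sub_eq_zero] at h
    rw [Complex.cpow_neg, ← h, mul_inv_cancel₀ hsα] at hlt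
    simp at hlt
  have hne' : 1 - lam * (s ^ (α : ℂ))⁻¹ ≠ 0 := by
    intro h
    apply hne
    field_simp at h
    simpa using h
  field_simp

/-- If `g` is holomorphic on the closed right half-plane minus the origin and dominated on the
strip `0 ≤ re s ≤ c` by an integrable function of `im s` that vanishes at infinity, then its
integral along `re s = c` equals its integral along the imaginary axis. -/
theorem integral_vertical_eq_integral_imaginary {g : ℂ → ℂ} {c : ℝ} (hc : 0 < c) {B : ℝ → ℝ}
    (hg : ∀ s : ℂ, 0 ≤ s.re → s ≠ 0 → DifferentiableAt ℂ g s)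
    (hgB : ∀ s : ℂ, 0 ≤ s.re → s.re ≤ c → s.im ≠ 0 → ‖g s‖ ≤ B s.im)
    (hB : Integrable B) (hB_top : Tendsto B atTop (𝓝 0)) (hB_bot : Tendsto B atBot (𝓝 0)) :
    ∫ y : ℝ, g (c + y * Complex.I) = ∫ y : ℝ, g (y * Complex.I) := by
  have hne : ∀ᵐ y : ℝ, y ≠ 0 := by
    simp [ae_iff, measure_singleton]
  have hcont {x : ℝ} (hx : 0 < x) : Continuous fun y : ℝ => g (x + y * Complex.I) := by
    rw [continuous_iff_continuousAt]
    intro y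
    have h : ContinuousAt g (x + y * Complex.I) :=
      (hg _ (by simpa using hx.le) (Complex.ne_zero_of_re_pos (by simpa using hx))).continuousAt
    exact h.comp (f := fun y : ℝ => (x + y * Complex.I : ℂ)) (by fun_prop)
  have hbd {x : ℝ} (hx : 0 ≤ x) (hxc : x ≤ c) {y : ℝ} (hy : y ≠ 0) :
      ‖g (x + y * Complex.I)‖ ≤ B y := by
    simpa using hgB (x + y * Complex.I) (by simpa using hx) (by simpa using hxc) (by simpa using hy)
  have hint {x : ℝ} (hx : 0 < x) (hxc : x ≤ c) :
      Integrable fun y : ℝ => g (x + y * Complex.I) := by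
    refine hB.mono' (hcont hx).aestronglyMeasurable ?_
    filter_upwards [hne] with y hy using hbd hx.le hxc hy
  have hside {T : ℝ → ℝ} (hT : ∀ᶠ t in atTop, T t ≠ 0)
      (hTB : Tendsto (fun t => B (T t)) atTop (𝓝 0)) {ε : ℝ} (hε : 0 < ε) (hεc : ε ≤ c) :
      Tendsto (fun t => ∫ x in ε..c, g (x + T t * Complex.I)) atTop (𝓝 0) := by
    refine squeeze_zero_norm' (a := fun t => B (T t) * |c - ε|) ?_ (by simpa using hTB.mul_const _)
    filter_upwards [hT] with t ht
    refine intervalIntegral.norm_integral_le_of_norm_le_const fun x hx => ?_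
    rw [uIoc_of_le hεc] at hx
    exact hbd (hε.le.trans hx.1.le) hx.2 ht
  have hshift {ε : ℝ} (hε : 0 < ε) (hεc : ε ≤ c) :
      ∫ y : ℝ, g (ε + y * Complex.I) = ∫ y : ℝ, g (c + y * Complex.I) := by
    have hrect (t : ℝ) := Complex.integral_boundary_rect_eq_zero_of_differentiableOn g
      (⟨ε, -t⟩ : ℂ) (⟨c, t⟩ : ℂ) (by
        intro s hs
        rw [Complex.mem_reProdIm, uIcc_of_le hεc] at hs
        have : 0 < s.re := hε.trans_le hs.1.1
        exact (hg s this.le (Complex.ne_zero_of_re_pos this)).differentiableWithinAt)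
    simp only at hrect
    have h1 := hside (T := fun t => -t)
      ((eventually_gt_atTop 0).mono fun t ht => by simpa using ht.ne')
      (hB_bot.comp tendsto_neg_atTop_atBot) hε hεc
    have h2 := hside (T := fun t => t) ((eventually_gt_atTop 0).mono fun t ht => ht.ne')
      hB_top hε hεc
    have h3 := intervalIntegral_tendsto_integral (hint hc le_rfl) tendsto_neg_atTop_atBot tendsto_id
    have h4 := intervalIntegral_tendsto_integral (hint hε hεc) tendsto_neg_atTop_atBot tendsto_id
    have h5 := ((h1.sub h2).add (h3.const_smul Complex.I)).sub (h4.const_smul Complex.I)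
    simp only [id] at h5
    have h6 := tendsto_nhds_unique (h5.congr hrect) tendsto_const_nhds
    rw [sub_zero, zero_add, ← smul_sub, smul_eq_zero, or_iff_right Complex.I_ne_zero,
      sub_eq_zero] at h6
    exact h6.symm
  have hlim : Tendsto (fun ε : ℝ => ∫ y : ℝ, g (ε + y * Complex.I)) (𝓝[>] 0)
      (𝓝 (∫ y : ℝ, g (y * Complex.I))) := by
    have hmem : ∀ᶠ ε : ℝ in 𝓝[>] 0, 0 < ε ∧ ε ≤ c :=
      (eventually_mem_nhdsWithin.and
        (nhdsWithin_le_nhds (eventually_le_nhds hc)))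
    refine tendsto_integral_filter_of_dominated_convergence B ?_ ?_ hB ?_
    · exact hmem.mono fun ε hε => (hcont hε.1).aestronglyMeasurable
    · filter_upwards [hmem] with ε hε
      filter_upwards [hne] with y hy using hbd hε.1.le hε.2 hy
    · filter_upwards [hne] with y hy
      have h : ContinuousAt g (y * Complex.I) := (hg _ (by simp) (by simpa using hy)).continuousAt
      have h' : Tendsto (fun ε : ℝ => (ε + y * Complex.I : ℂ)) (𝓝[>] 0) (𝓝 (y * Complex.I)) := by
        refine Tendsto.mono_left (Continuous.tendsto' (by fun_prop) _ _ (by simp))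
          nhdsWithin_le_nhds
      exact h.tendsto.comp h'
  refine tendsto_nhds_unique (tendsto_const_nhds.congr' ?_) hlim
  filter_upwards [self_mem_nhdsWithin, nhdsWithin_le_nhds (eventually_le_nhds hc)] with ε hε hεc
  exact (hshift hε hεc).symm

theorem integrable_comp_abs_of_integrableOn_Ioi {f : ℝ → ℝ} (hf : IntegrableOn f (Ioi 0)) :
    Integrable fun x => f |x| := by
  have hpos : IntegrableOn (fun x => f |x|) (Ioi 0) :=
    hf.congr_fun (fun x hx => by rw [abs_of_pos hx]) measurableSet_Ioi
  have hneg : IntegrableOn (fun x => f |x|) (Iic 0) := by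
    have hm : MeasurableEmbedding fun x : ℝ => -x := (Homeomorph.neg ℝ).measurableEmbedding
    rw [← Measure.map_neg_eq_self (volume : Measure ℝ), hm.integrableOn_map_iff]
    simpa [Function.comp_def] using (integrableOn_Ici_iff_integrableOn_Ioi (by simp)).2 hpos
  rw [← integrableOn_univ, ← Iic_union_Ioi (a := (0 : ℝ))]
  exact hneg.union hpos

/-- The dominating weight `|y| ^ (α - 1)` near the origin and `|y| ^ (-1 - α)` at infinity. -/
noncomputable def verticalWeight (α y : ℝ) : ℝ :=
  if |y| ≤ 2 then |y| ^ (α - 1) else |y| ^ (-1 - α)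

theorem integrable_verticalWeight {α : ℝ} (hα : 0 < α) : Integrable (verticalWeight α) := by
  refine integrable_comp_abs_of_integrableOn_Ioi
    (f := fun x : ℝ => if x ≤ 2 then x ^ (α - 1) else x ^ (-1 - α)) ?_
  rw [← Ioc_union_Ioi_eq_Ioi (zero_le_two (α := ℝ))]
  refine IntegrableOn.union ?_ ?_
  · have h := intervalIntegral.intervalIntegrable_rpow' (a := 0) (b := 2) (r := α - 1)
      (by linarith)
    rw [intervalIntegrable_iff_integrableOn_Ioc_of_le zero_le_two] at h
    exact h.congr_fun (fun x hx => by simp [hx.2]) measurableSet_Ioc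
  · refine (integrableOn_Ioi_rpow_of_lt (a := -1 - α) (by linarith) two_pos).congr_fun
      (fun x hx => ?_) measurableSet_Ioi
    simp [not_le.2 (mem_Ioi.1 hx)]

theorem tendsto_verticalWeight_cocompact {α : ℝ} (hα : 0 < α) :
    Tendsto (verticalWeight α) (cocompact ℝ) (𝓝 0) := by
  have h1 : Tendsto (fun y : ℝ => |y| ^ (-(1 + α))) (cocompact ℝ) (𝓝 0) :=
    (tendsto_rpow_neg_atTop (by linarith)).comp (tendsto_norm_cocompact_atTop (E := ℝ))
  refine h1.congr' ?_
  filter_upwards [(tendsto_norm_cocompact_atTop (E := ℝ)).eventually_gt_atTop 2] with y hy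
  rw [Real.norm_eq_abs] at hy
  rw [verticalWeight, if_neg (not_le.2 hy)]
  congr 1
  ring

theorem mem_slitPlane_of_re_nonneg {s : ℂ} (hs : 0 ≤ s.re) (h0 : s ≠ 0) :
    s ∈ Complex.slitPlane := by
  rw [Complex.mem_slitPlane_iff]
  by_contra! h
  exact h0 (Complex.ext (le_antisymm h.1 hs) h.2)

theorem cpow_eq_cpow_of_re_nonneg {α : ℝ} (hα₀ : 0 < α) (hα₁ : α < 1) {s w : ℂ}
    (hs : 0 ≤ s.re) (hw : 0 ≤ w.re) (hs0 : s ≠ 0) (hw0 : w ≠ 0)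
    (h : s ^ (α : ℂ) = w ^ (α : ℂ)) : s = w := by
  have key {u : ℂ} (hu : 0 ≤ u.re) (hu0 : u ≠ 0) :
      Complex.log (u ^ (α : ℂ)) = Complex.log u * α := by
    have harg := abs_le.1 (Complex.abs_arg_le_pi_div_two_iff.2 hu)
    have him : (Complex.log u * α).im = u.arg * α := by simp [Complex.log_im]
    rw [Complex.cpow_def_of_ne_zero hu0, Complex.log_exp]
    · rw [him]; nlinarith [Real.pi_pos]
    · rw [him]; nlinarith [Real.pi_pos]
  have h1 := key hs hs0
  rw [h, key hw hw0] at h1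
  have h2 := mul_right_cancel₀ (by exact_mod_cast hα₀.ne') h1
  rw [← Complex.exp_log hs0, ← Complex.exp_log hw0, h2]

/-- The difference quotient `(s ^ α - I ^ α) / (s - I)`. -/
noncomputable def powQuotient (α : ℝ) : ℂ → ℂ :=
  dslope (fun s : ℂ => s ^ (α : ℂ)) Complex.I

/-- The holomorphic extension to `s = I` of
`s ^ (α - 1) / (s ^ α - I ^ α) - (1 / α) / (s - I) + (1 / α - 1) / (s + 1)`. -/
noncomputable def regularSymbol (α : ℝ) (s : ℂ) : ℂ :=
  dslope (fun s : ℂ => α * s ^ (α - 1 : ℂ) - powQuotient α s) Complex.I s /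
    (α * powQuotient α s) + (1 / α - 1) / (s + 1)

theorem powQuotient_I (α : ℝ) : powQuotient α Complex.I = α * Complex.I ^ (α - 1 : ℂ) := by
  rw [powQuotient, dslope_same]
  have := (hasDerivAt_id Complex.I).cpow_const (c := (α : ℂ)) (by simp [Complex.mem_slitPlane_iff])
  simpa using this.deriv

theorem powQuotient_of_ne (α : ℝ) {s : ℂ} (hs : s ≠ Complex.I) :
    powQuotient α s = (s ^ (α : ℂ) - Complex.I ^ (α : ℂ)) / (s - Complex.I) := by
  rw [powQuotient, dslope_of_ne _ hs, slope_def_field]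

theorem differentiableOn_powQuotient (α : ℝ) :
    DifferentiableOn ℂ (powQuotient α) Complex.slitPlane := by
  rw [powQuotient, Complex.differentiableOn_dslope
    (Complex.isOpen_slitPlane.mem_nhds (by simp [Complex.mem_slitPlane_iff]))]
  exact fun s hs => (differentiableAt_id.cpow_const hs).differentiableWithinAt

theorem powQuotient_ne_zero {α : ℝ} (hα₀ : 0 < α) (hα₁ : α < 1) {s : ℂ} (hs : 0 ≤ s.re)
    (h0 : s ≠ 0) : powQuotient α s ≠ 0 := by
  by_cases hI : s = Complex.I
  · rw [hI, powQuotient_I]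
    simp [Complex.cpow_eq_zero_iff, hα₀.ne']
  · rw [powQuotient_of_ne _ hI]
    refine div_ne_zero (fun h => hI ?_) (sub_ne_zero.2 hI)
    exact cpow_eq_cpow_of_re_nonneg hα₀ hα₁ hs (by simp) h0 Complex.I_ne_zero (sub_eq_zero.1 h)

theorem add_one_ne_zero_of_re_nonneg {s : ℂ} (hs : 0 ≤ s.re) : s + 1 ≠ 0 :=
  Complex.ne_zero_of_re_pos (by simp only [Complex.add_re, Complex.one_re]; linarith)

theorem differentiableAt_regularSymbol {α : ℝ} (hα₀ : 0 < α) (hα₁ : α < 1) {s : ℂ}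
    (hs : 0 ≤ s.re) (h0 : s ≠ 0) : DifferentiableAt ℂ (regularSymbol α) s := by
  have hmem := Complex.isOpen_slitPlane.mem_nhds (mem_slitPlane_of_re_nonneg hs h0)
  have hI : Complex.slitPlane ∈ 𝓝 Complex.I :=
    Complex.isOpen_slitPlane.mem_nhds (by simp [Complex.mem_slitPlane_iff])
  have hq := (differentiableOn_powQuotient α).differentiableAt hmem
  have hN : DifferentiableOn ℂ
      (dslope (fun s : ℂ => α * s ^ (α - 1 : ℂ) - powQuotient α s) Complex.I)
      Complex.slitPlane := by
    rw [Complex.differentiableOn_dslope hI]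
    refine DifferentiableOn.sub (fun w hw => ?_) (differentiableOn_powQuotient α)
    exact ((differentiableAt_id.cpow_const hw).const_mul _).differentiableWithinAt
  refine ((hN.differentiableAt hmem).div (hq.const_mul _) ?_).add
    ((differentiableAt_const _).div (differentiableAt_id.add_const _)
      (add_one_ne_zero_of_re_nonneg hs))
  exact mul_ne_zero (by exact_mod_cast hα₀.ne') (powQuotient_ne_zero hα₀ hα₁ hs h0)

theorem regularSymbol_eq {α : ℝ} (hα₀ : 0 < α) (hα₁ : α < 1) {s : ℂ} (hs : 0 ≤ s.re)
    (h0 : s ≠ 0) (hI : s ≠ Complex.I) :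
    regularSymbol α s = s ^ (α - 1 : ℂ) / (s ^ (α : ℂ) - Complex.I ^ (α : ℂ)) -
      1 / α / (s - Complex.I) + (1 / α - 1) / (s + 1) := by
  have hαC : (α : ℂ) ≠ 0 := by exact_mod_cast hα₀.ne'
  have h1 : s - Complex.I ≠ 0 := sub_ne_zero.2 hI
  have h2 : s ^ (α : ℂ) - Complex.I ^ (α : ℂ) ≠ 0 := fun h => hI <|
    cpow_eq_cpow_of_re_nonneg hα₀ hα₁ hs (by simp) h0 Complex.I_ne_zero (sub_eq_zero.1 h)
  rw [regularSymbol, dslope_of_ne _ hI, slope_def_field, powQuotient_I, powQuotient_of_ne _ hI]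
  congr 1
  field_simp
  ring

theorem norm_regularSymbol_le_of_two_lt {α : ℝ} (hα₀ : 0 < α) (hα₁ : α < 1) {s : ℂ}
    (hs : 0 ≤ s.re) (him : 2 < |s.im|) :
    ‖regularSymbol α s‖ ≤
      ((1 - 2 ^ (-α))⁻¹ + 1 + 4 / α) * |s.im| ^ (-1 - α) := by
  set y := |s.im|
  have hy : 0 < y := by linarith
  have h0 : s ≠ 0 := by rintro rfl; simp [y] at hy
  have hI : s ≠ Complex.I := by
    rintro rfl
    norm_num [y] at him
  have hlam : ‖Complex.I ^ (α : ℂ)‖ = 1 := by rw [Complex.norm_cpow_real]; simp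
  have hαC : (α : ℂ) ≠ 0 := by exact_mod_cast hα₀.ne'
  have h1 : s - Complex.I ≠ 0 := sub_ne_zero.2 hI
  have h2 : s ^ (α : ℂ) - Complex.I ^ (α : ℂ) ≠ 0 := fun h => hI <|
    cpow_eq_cpow_of_re_nonneg hα₀ hα₁ hs (by simp) h0 Complex.I_ne_zero (sub_eq_zero.1 h)
  have h3 := add_one_ne_zero_of_re_nonneg hs
  have heq : regularSymbol α s =
      Complex.I ^ (α : ℂ) / (s * (s ^ (α : ℂ) - Complex.I ^ (α : ℂ))) + 1 / (s * (s + 1)) -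
        1 / α * ((1 + Complex.I) / ((s - Complex.I) * (s + 1))) := by
    rw [regularSymbol_eq hα₀ hα₁ hs h0 hI, Complex.cpow_sub _ _ h0, Complex.cpow_one]
    field_simp
    ring
  have hκ : 0 < 1 - (2 : ℝ) ^ (-α) := by
    have := Real.rpow_lt_one_of_one_lt_of_neg (x := 2) (z := -α) one_lt_two (by linarith)
    linarith
  have n1 : y ≤ ‖s‖ := Complex.abs_im_le_norm s
  have n2 : y ≤ ‖s + 1‖ := by simpa using Complex.abs_im_le_norm (s + 1)
  have n3 : y / 2 ≤ ‖s - Complex.I‖ := by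
    have := norm_sub_norm_le s Complex.I
    rw [Complex.norm_I] at this
    linarith
  have n4 : (1 - 2 ^ (-α)) * y ^ α ≤ ‖s ^ (α : ℂ) - Complex.I ^ (α : ℂ)‖ := by
    have h := norm_sub_norm_le (s ^ (α : ℂ)) (Complex.I ^ (α : ℂ))
    rw [hlam, Complex.norm_cpow_real] at h
    have h' : y ^ α ≤ ‖s‖ ^ α := by gcongr
    have h'' : 1 ≤ (2 : ℝ) ^ (-α) * y ^ α := by
      rw [Real.rpow_neg zero_le_two, inv_mul_eq_div, one_le_div (by positivity)]
      gcongr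
    linarith
  have hpow : y ^ (-1 - α) = (y * y ^ α)⁻¹ := by
    rw [← Real.rpow_one_add' hy.le (by linarith), ← Real.rpow_neg hy.le]
    congr 1
    ring
  have hpow2 : (y * y)⁻¹ ≤ y ^ (-1 - α) := by
    rw [hpow]
    have : y ^ α ≤ y ^ (1 : ℝ) := Real.rpow_le_rpow_of_exponent_le (by linarith) hα₁.le
    rw [Real.rpow_one] at this
    gcongr
  have t1 : ‖Complex.I ^ (α : ℂ) / (s * (s ^ (α : ℂ) - Complex.I ^ (α : ℂ)))‖ ≤
      (1 - 2 ^ (-α))⁻¹ * y ^ (-1 - α) := by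
    rw [norm_div, hlam, norm_mul, one_div, hpow, ← mul_inv]
    refine inv_anti₀ (by positivity) ?_
    calc (1 - 2 ^ (-α)) * (y * y ^ α) = y * ((1 - 2 ^ (-α)) * y ^ α) := by ring
      _ ≤ _ := by gcongr
  have t2 : ‖1 / (s * (s + 1))‖ ≤ y ^ (-1 - α) := by
    rw [norm_div, norm_one, norm_mul, one_div]
    refine le_trans (inv_anti₀ (by positivity) ?_) hpow2
    gcongr
  have t3 : ‖1 / α * ((1 + Complex.I) / ((s - Complex.I) * (s + 1)))‖ ≤
      4 / α * y ^ (-1 - α) := by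
    have hn : ‖1 + Complex.I‖ ≤ 2 := (norm_add_le _ _).trans (by simp; norm_num)
    rw [norm_mul, norm_div, norm_div, norm_one, norm_mul, Complex.norm_real,
      Real.norm_of_nonneg hα₀.le]
    calc 1 / α * (‖1 + Complex.I‖ / (‖s - Complex.I‖ * ‖s + 1‖))
        ≤ 1 / α * (2 / (y / 2 * y)) := by gcongr
      _ = 4 / α * (y * y)⁻¹ := by field_simp; norm_num
      _ ≤ _ := by gcongr
  rw [heq]
  refine (norm_sub_le _ _).trans ((add_le_add ((norm_add_le _ _).trans (add_le_add t1 t2))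
    t3).trans_eq ?_)
  ring

theorem norm_regularSymbol_le_of_small {α : ℝ} (hα₀ : 0 < α) (hα₁ : α < 1) {s : ℂ}
    (hs : 0 ≤ s.re) (him : s.im ≠ 0) (hsmall : ‖s‖ ≤ (1 / 2) ^ (1 / α)) :
    ‖regularSymbol α s‖ ≤ (2 + 4 / α) * |s.im| ^ (α - 1) := by
  have h0 : s ≠ 0 := by rintro rfl; simp at him
  have hspos : 0 < ‖s‖ := norm_pos_iff.2 h0
  have hhalf : ‖s‖ ≤ 1 / 2 := by
    refine hsmall.trans ?_
    conv_rhs => rw [← Real.rpow_one (1 / 2 : ℝ)]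
    exact Real.rpow_le_rpow_of_exponent_ge (by norm_num) (by norm_num)
      (by rw [le_div_iff₀ hα₀]; linarith)
  have hsα : ‖s‖ ^ α ≤ 1 / 2 := by
    calc ‖s‖ ^ α ≤ ((1 / 2) ^ (1 / α)) ^ α := by gcongr
      _ = 1 / 2 := by rw [one_div α, Real.rpow_inv_rpow (by norm_num) hα₀.ne']
  have hI : s ≠ Complex.I := by
    rintro rfl
    norm_num at hhalf
  have hlam : ‖Complex.I ^ (α : ℂ)‖ = 1 := by rw [Complex.norm_cpow_real]; simp
  have n1 : 1 / 2 ≤ ‖s ^ (α : ℂ) - Complex.I ^ (α : ℂ)‖ := by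
    have h := norm_sub_norm_le (Complex.I ^ (α : ℂ)) (s ^ (α : ℂ))
    rw [norm_sub_rev, hlam, Complex.norm_cpow_real] at h
    linarith
  have n2 : 1 / 2 ≤ ‖s - Complex.I‖ := by
    have h := norm_sub_norm_le Complex.I s
    rw [norm_sub_rev, Complex.norm_I] at h
    linarith
  have n3 : 1 ≤ ‖s + 1‖ := by
    refine le_trans ?_ (Complex.re_le_norm _)
    simpa using hs
  have n4 : ‖s‖ ^ (α - 1) ≤ |s.im| ^ (α - 1) :=
    Real.rpow_le_rpow_of_nonpos (abs_pos.2 him) (Complex.abs_im_le_norm s) (by linarith)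
  have n5 : 1 ≤ |s.im| ^ (α - 1) :=
    (Real.one_le_rpow_of_pos_of_le_one_of_nonpos hspos (by linarith) (by linarith)).trans n4
  have t1 : ‖s ^ (α - 1 : ℂ) / (s ^ (α : ℂ) - Complex.I ^ (α : ℂ))‖ ≤ 2 * |s.im| ^ (α - 1) := by
    have : (α - 1 : ℂ) = ((α - 1 : ℝ) : ℂ) := by push_cast; rfl
    rw [norm_div, this, Complex.norm_cpow_real]
    calc _ ≤ |s.im| ^ (α - 1) / (1 / 2) := by gcongr
      _ = _ := by ring
  have t2 : ‖(1 / α : ℂ) / (s - Complex.I)‖ ≤ 2 / α := by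
    rw [norm_div, norm_div, norm_one, Complex.norm_real, Real.norm_of_nonneg hα₀.le]
    calc _ ≤ 1 / α / (1 / 2) := by gcongr
      _ = _ := by ring
  have t3 : ‖(1 / α - 1 : ℂ) / (s + 1)‖ ≤ 2 / α := by
    have h : ‖(1 / α - 1 : ℂ)‖ ≤ 2 / α := by
      have h1 : (1 / α - 1 : ℂ) = ((1 / α - 1 : ℝ) : ℂ) := by push_cast; rfl
      have h2 : 1 ≤ 1 / α := by rw [le_div_iff₀ hα₀]; linarith
      have h3 : 2 / α = 1 / α + 1 / α := by ring
      rw [h1, Complex.norm_real, Real.norm_of_nonneg (by linarith), h3]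
      linarith
    rw [norm_div]
    calc _ ≤ 2 / α / 1 := by gcongr
      _ = _ := by ring
  rw [regularSymbol_eq hα₀ hα₁ hs h0 hI]
  refine (norm_add_le _ _).trans ((add_le_add ((norm_sub_le _ _).trans (add_le_add t1 t2))
    t3).trans ?_)
  have : 0 < 4 / α := by positivity
  have h4 : 4 / α = 2 / α + 2 / α := by ring
  nlinarith

theorem exists_norm_regularSymbol_le {α : ℝ} (hα₀ : 0 < α) (hα₁ : α < 1) (c : ℝ) :
    ∃ C : ℝ, 0 ≤ C ∧ ∀ s : ℂ, 0 ≤ s.re → s.re ≤ c → s.im ≠ 0 →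
      ‖regularSymbol α s‖ ≤ C * verticalWeight α s.im := by
  set δ : ℝ := (1 / 2) ^ (1 / α)
  have hδ : 0 < δ := by positivity
  set K : Set ℂ := (Icc 0 c ×ℂ Icc (-2) 2) ∩ {s | δ ≤ ‖s‖}
  have hK : IsCompact K :=
    (isCompact_Icc.reProdIm isCompact_Icc).inter_right
      (isClosed_le continuous_const continuous_norm)
  obtain ⟨M, hM⟩ := hK.exists_bound_of_continuousOn (f := regularSymbol α) fun s hs =>
    (differentiableAt_regularSymbol hα₀ hα₁ hs.1.1.1
      (norm_pos_iff.1 (hδ.trans_le hs.2))).continuousAt.continuousWithinAt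
  have hκ : 0 < 1 - (2 : ℝ) ^ (-α) := by
    have := Real.rpow_lt_one_of_one_lt_of_neg (x := 2) (z := -α) one_lt_two (by linarith)
    linarith
  set a := (1 - (2 : ℝ) ^ (-α))⁻¹ + 1 + 4 / α
  set b := 2 + 4 / α
  set d := |M| * 2 ^ (1 - α)
  have ha : 0 ≤ a := by positivity
  have hb : 0 ≤ b := by positivity
  have hd : 0 ≤ d := by positivity
  refine ⟨a + b + d, by positivity, fun s hs hsc him => ?_⟩
  have hy : 0 < |s.im| := abs_pos.2 him
  rcases lt_or_ge 2 |s.im| with h2 | h2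
  · rw [verticalWeight, if_neg (not_le.2 h2)]
    refine (norm_regularSymbol_le_of_two_lt hα₀ hα₁ hs h2).trans ?_
    exact mul_le_mul_of_nonneg_right (show a ≤ a + b + d by linarith) (by positivity)
  · rw [verticalWeight, if_pos h2]
    rcases le_or_gt ‖s‖ δ with h3 | h3
    · refine (norm_regularSymbol_le_of_small hα₀ hα₁ hs him h3).trans ?_
      exact mul_le_mul_of_nonneg_right (show b ≤ a + b + d by linarith) (by positivity)
    · have h4 := hM s ⟨⟨⟨hs, hsc⟩, abs_le.1 h2⟩, h3.le⟩
      have h5 : (2 : ℝ) ^ (α - 1) ≤ |s.im| ^ (α - 1) :=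
        Real.rpow_le_rpow_of_nonpos hy h2 (by linarith)
      have h6 : (2 : ℝ) ^ (1 - α) * 2 ^ (α - 1) = 1 := by
        rw [← Real.rpow_add two_pos]; simp
      calc ‖regularSymbol α s‖ ≤ |M| * (2 ^ (1 - α) * 2 ^ (α - 1)) := by
            rw [h6, mul_one]; exact h4.trans (le_abs_self M)
        _ ≤ |M| * (2 ^ (1 - α) * |s.im| ^ (α - 1)) := by gcongr
        _ = d * |s.im| ^ (α - 1) := by ring
        _ ≤ _ := by gcongr; linarith

/-- The difference between `E_α(I ^ α x ^ α)` and its main oscillating term, corrected by a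
decaying exponential so that it vanishes at the origin. -/
noncomputable def mittagLefflerRemainder (α x : ℝ) : ℂ :=
  mittagLeffler α 1 (Complex.I ^ (α : ℂ) * ((x ^ α : ℝ) : ℂ)) -
    1 / α * Complex.exp (Complex.I * x) + (1 / α - 1) * Complex.exp (-x)

theorem norm_I_cpow (α : ℝ) : ‖Complex.I ^ (α : ℂ)‖ = 1 := by
  rw [Complex.norm_cpow_real]; simp

theorem continuous_mittagLeffler_rpow {α : ℝ} (hα : 0 < α) :
    Continuous fun x : ℝ => mittagLeffler α 1 (Complex.I ^ (α : ℂ) * ((x ^ α : ℝ) : ℂ)) := by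
  have h : Continuous fun x : ℝ => x ^ α := Real.continuous_rpow_const hα.le
  exact (continuous_mittagLeffler hα).comp
    (continuous_const.mul (Complex.continuous_ofReal.comp h))

theorem continuous_mittagLefflerRemainder {α : ℝ} (hα : 0 < α) :
    Continuous (mittagLefflerRemainder α) :=
  ((continuous_mittagLeffler_rpow hα).sub (by fun_prop)).add (by fun_prop)

theorem mittagLefflerRemainder_zero {α : ℝ} (hα : 0 < α) : mittagLefflerRemainder α 0 = 0 := by
  have h : mittagLeffler α 1 0 = 1 := by
    rw [mittagLeffler, tsum_eq_single 0]
    · simp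
    · intro k hk
      simp [hk]
  simp [mittagLefflerRemainder, Real.zero_rpow hα.ne', h]

theorem norm_mittagLeffler_rpow_le {α : ℝ} (hα : 0 < α) {x : ℝ} (hx : 0 < x) :
    ‖mittagLeffler α 1 (Complex.I ^ (α : ℂ) * ((x ^ α : ℝ) : ℂ))‖ ≤
      Real.exp (2 ^ α⁻¹ * x) * 2 := by
  refine norm_mittagLeffler_le hα (by positivity) (le_of_eq ?_)
  rw [norm_mul, norm_I_cpow, Complex.norm_real, Real.norm_of_nonneg (by positivity), one_mul,
    Real.mul_rpow (by positivity) hx.le, Real.rpow_inv_rpow zero_le_two hα.ne']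
  ring

theorem integrableOn_mittagLeffler_rpow_mul_cexp {α : ℝ} (hα : 0 < α) {s : ℂ}
    (hs : 2 ^ α⁻¹ < s.re) :
    IntegrableOn (fun x : ℝ => mittagLeffler α 1 (Complex.I ^ (α : ℂ) * ((x ^ α : ℝ) : ℂ)) *
      Complex.exp (-(s * x))) (Ioi 0) := by
  have hint := (integrableOn_rpow_mul_exp_neg_mul_Ioi (a := 0) le_rfl (sub_pos.2 hs)).const_mul 2
  refine hint.mono'
    ((continuous_mittagLeffler_rpow hα).mul (by fun_prop)).aestronglyMeasurable ?_
  filter_upwards [ae_restrict_mem measurableSet_Ioi] with x hx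
  rw [norm_mul, Complex.norm_exp]
  calc _ ≤ Real.exp (2 ^ α⁻¹ * x) * 2 * Real.exp (-(s * x)).re := by
        gcongr
        exact norm_mittagLeffler_rpow_le hα hx
    _ = 2 * Real.exp (2 ^ α⁻¹ * x + (-(s * x)).re) := by rw [Real.exp_add]; ring
    _ = _ := by
        rw [Real.rpow_zero, one_mul]
        congr 2
        simp only [Complex.neg_re, Complex.re_mul_ofReal]
        ring

theorem integral_cexp_mul_cexp_neg_mul_Ioi {a s : ℂ} (h : a.re < s.re) :
    IntegrableOn (fun x : ℝ => Complex.exp (a * x) * Complex.exp (-(s * x))) (Ioi 0) ∧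
      ∫ x : ℝ in Ioi 0, Complex.exp (a * x) * Complex.exp (-(s * x)) = 1 / (s - a) := by
  have hfun : (fun x : ℝ => Complex.exp (a * x) * Complex.exp (-(s * x))) =
      fun x : ℝ => Complex.exp ((a - s) * x) := by
    ext x
    rw [← Complex.exp_add]
    congr 1
    ring
  have hre : (a - s).re < 0 := by simpa using h
  rw [hfun]
  refine ⟨integrableOn_exp_mul_complex_Ioi hre 0, ?_⟩
  rw [integral_exp_mul_complex_Ioi hre 0, ← neg_sub s a]
  simp [neg_div_neg_eq, -neg_sub]

theorem mittagLefflerRemainder_laplace {α : ℝ} (hα₀ : 0 < α) (hα₁ : α < 1) {s : ℂ}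
    (hs : 2 ^ α⁻¹ < s.re) :
    IntegrableOn (fun x : ℝ => mittagLefflerRemainder α x * Complex.exp (-(s * x))) (Ioi 0) ∧
      ∫ x : ℝ in Ioi 0, mittagLefflerRemainder α x * Complex.exp (-(s * x)) =
        regularSymbol α s := by
  have hs1 : 1 < s.re := (Real.one_lt_rpow one_lt_two (by positivity)).trans hs
  have hs0 : 0 ≤ s.re := by linarith
  have hsI : s ≠ Complex.I := by rintro rfl; norm_num at hs1
  have h1 := integrableOn_mittagLeffler_rpow_mul_cexp hα₀ hs
  obtain ⟨h2, h2'⟩ := integral_cexp_mul_cexp_neg_mul_Ioi (a := Complex.I) (s := s)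
    (by simp; linarith)
  obtain ⟨h3, h3'⟩ := integral_cexp_mul_cexp_neg_mul_Ioi (a := -1) (s := s)
    (by simp; linarith)
  have hfun : (fun x : ℝ => mittagLefflerRemainder α x * Complex.exp (-(s * x))) = fun x : ℝ =>
      mittagLeffler α 1 (Complex.I ^ (α : ℂ) * ((x ^ α : ℝ) : ℂ)) * Complex.exp (-(s * x)) -
        1 / α * (Complex.exp (Complex.I * x) * Complex.exp (-(s * x))) +
        (1 / α - 1) * (Complex.exp (-1 * x) * Complex.exp (-(s * x))) := by
    ext x
    rw [mittagLefflerRemainder, neg_one_mul]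
    ring
  rw [hfun]
  have h12 : IntegrableOn (fun x : ℝ =>
      mittagLeffler α 1 (Complex.I ^ (α : ℂ) * ((x ^ α : ℝ) : ℂ)) * Complex.exp (-(s * x)) -
        1 / α * (Complex.exp (Complex.I * x) * Complex.exp (-(s * x)))) (Ioi 0) :=
    h1.sub (h2.const_mul (1 / α : ℂ))
  refine ⟨h12.add (h3.const_mul (1 / α - 1 : ℂ)), ?_⟩
  rw [integral_add h12 (h3.const_mul _), integral_sub h1 (h2.const_mul _), integral_const_mul,
    integral_const_mul, h2', h3', integral_mittagLeffler_mul_cexp_neg_mul_Ioi hα₀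
    (norm_I_cpow α) hs1, regularSymbol_eq hα₀ hα₁ hs0 (Complex.ne_zero_of_re_pos (by linarith)) hsI]
  simp only [sub_neg_eq_add]
  ring

theorem mittagLefflerRemainder_eq_vertical {α : ℝ} (hα₀ : 0 < α) (hα₁ : α < 1) {c : ℝ}
    (hc : 2 ^ α⁻¹ < c) {x : ℝ} (hx : 0 ≤ x) :
    mittagLefflerRemainder α x = (2 * π)⁻¹ *
      ∫ y : ℝ, Complex.exp ((c + y * Complex.I) * x) * regularSymbol α (c + y * Complex.I) := by
  have hc0 : 0 < c := lt_trans (by positivity) hc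
  set φ : ℝ → ℂ := fun x => mittagLefflerRemainder α (max x 0) * Complex.exp (-(c * x))
  have hφc : Continuous φ :=
    ((continuous_mittagLefflerRemainder hα₀).comp (by fun_prop)).mul (by fun_prop)
  have hφ0 {x : ℝ} (hx : x ∉ Ioi (0 : ℝ)) : φ x = 0 := by
    simp [φ, max_eq_right (notMem_Ioi.1 hx), mittagLefflerRemainder_zero hα₀]
  have hφpos : ∀ x ∈ Ioi (0 : ℝ),
      φ x = mittagLefflerRemainder α x * Complex.exp (-((c : ℂ) * x)) := by
    intro x hx
    simp only [φ]
    rw [max_eq_left (le_of_lt hx)]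
  have hφi : Integrable φ := by
    rw [← integrableOn_iff_integrable_of_support_subset (s := Ioi 0)
      (fun x hx => by_contra fun h => hx (hφ0 h))]
    exact (mittagLefflerRemainder_laplace hα₀ hα₁ (s := c) (by simpa using hc)).1.congr_fun
      (fun x hx => (hφpos x hx).symm) measurableSet_Ioi
  have hF : FourierTransform.fourier φ =
      fun w : ℝ => regularSymbol α (c + (2 * π * w : ℝ) * Complex.I) := by
    ext w
    rw [Real.fourier_real_eq_integral_exp_smul,
      ← setIntegral_eq_integral_of_forall_compl_eq_zero (s := Ioi 0)
        (fun x hx => by rw [hφ0 hx, smul_zero]),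
      ← (mittagLefflerRemainder_laplace hα₀ hα₁ (s := c + (2 * π * w : ℝ) * Complex.I)
        (by simpa using hc)).2]
    refine setIntegral_congr_fun measurableSet_Ioi fun x hx => ?_
    rw [hφpos x hx, smul_eq_mul, mul_left_comm, ← Complex.exp_add]
    congr 2
    push_cast
    ring
  obtain ⟨C, -, hC⟩ := exists_norm_regularSymbol_le hα₀ hα₁ c
  have hcont : Continuous fun y : ℝ => regularSymbol α (c + y * Complex.I) := by
    rw [continuous_iff_continuousAt]
    intro y
    have h : ContinuousAt (regularSymbol α) (c + y * Complex.I) :=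
      (differentiableAt_regularSymbol hα₀ hα₁ (by simpa using hc0.le)
        (Complex.ne_zero_of_re_pos (by simpa using hc0))).continuousAt
    exact h.comp (f := fun y : ℝ => (c + y * Complex.I : ℂ)) (by fun_prop)
  have hint : Integrable fun y : ℝ => regularSymbol α (c + y * Complex.I) := by
    refine ((integrable_verticalWeight hα₀).const_mul C).mono' hcont.aestronglyMeasurable ?_
    have hne : ∀ᵐ y : ℝ, y ≠ 0 := by simp [ae_iff, measure_singleton]
    filter_upwards [hne] with y hy
    simpa using hC (c + y * Complex.I) (by simpa using hc0.le) (by simp) (by simpa using hy)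
  have hFi : Integrable (FourierTransform.fourier φ) := by
    rw [hF]
    exact hint.comp_mul_left' (R := 2 * π) (by positivity)
  have hinv := congrFun (hφc.fourierInv_fourier_eq hφi hFi) x
  rw [hF, Real.fourierInv_eq'] at hinv
  have hscale := Measure.integral_comp_mul_left (fun y : ℝ =>
    Complex.exp (y * x * Complex.I) * regularSymbol α (c + y * Complex.I)) (2 * π)
  have hcongr : ∫ v : ℝ, Complex.exp ((2 * π * inner ℝ v x : ℝ) * Complex.I) •
        regularSymbol α (c + (2 * π * v : ℝ) * Complex.I) =
      (2 * π)⁻¹ * ∫ y : ℝ, Complex.exp (y * x * Complex.I) *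
        regularSymbol α (c + y * Complex.I) := by
    rw [abs_of_pos (by positivity), Complex.real_smul] at hscale
    push_cast at hscale ⊢
    rw [← hscale]
    refine integral_congr_ae (Eventually.of_forall fun v => ?_)
    simp only [smul_eq_mul]
    congr 2
    simp
    ring
  rw [hcongr] at hinv
  have hφx : φ x = mittagLefflerRemainder α x * Complex.exp (-((c : ℂ) * x)) := by
    simp only [φ, max_eq_left hx]
  have hfac : ∀ y : ℝ, Complex.exp ((c + y * Complex.I) * x) * regularSymbol α (c + y * Complex.I)
      = Complex.exp (c * x) *
        (Complex.exp (y * x * Complex.I) * regularSymbol α (c + y * Complex.I)) := by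
    intro y
    rw [← mul_assoc, ← Complex.exp_add]
    congr 2
    ring
  simp_rw [hfac]
  rw [integral_const_mul, mul_left_comm, hinv, hφx, mul_left_comm, ← Complex.exp_add]
  simp

theorem mittagLefflerRemainder_eq_imaginary {α : ℝ} (hα₀ : 0 < α) (hα₁ : α < 1) {x : ℝ}
    (hx : 0 ≤ x) :
    mittagLefflerRemainder α x = (2 * π)⁻¹ *
      ∫ y : ℝ, Complex.exp (y * Complex.I * x) * regularSymbol α (y * Complex.I) := by
  set c : ℝ := 2 ^ α⁻¹ + 1
  have hc : 2 ^ α⁻¹ < c := lt_add_one _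
  have hc0 : 0 < c := by positivity
  obtain ⟨C, hC0, hC⟩ := exists_norm_regularSymbol_le hα₀ hα₁ c
  have hlim := (tendsto_verticalWeight_cocompact hα₀).const_mul (Real.exp (c * x) * C)
  rw [mul_zero] at hlim
  rw [mittagLefflerRemainder_eq_vertical hα₀ hα₁ hc hx,
    integral_vertical_eq_integral_imaginary
      (g := fun s => Complex.exp (s * x) * regularSymbol α s) hc0
      (B := fun y => Real.exp (c * x) * C * verticalWeight α y) ?_ ?_
      ((integrable_verticalWeight hα₀).const_mul _)
      (hlim.mono_left atTop_le_cocompact) (hlim.mono_left atBot_le_cocompact)]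
  · intro s hs h0
    exact DifferentiableAt.mul (by fun_prop) (differentiableAt_regularSymbol hα₀ hα₁ hs h0)
  · intro s hs hsc him
    rw [norm_mul, Complex.norm_exp, Complex.re_mul_ofReal, mul_assoc]
    gcongr
    exact hC s hs hsc him

theorem tendsto_mittagLefflerRemainder {α : ℝ} (hα₀ : 0 < α) (hα₁ : α < 1) :
    Tendsto (mittagLefflerRemainder α) atTop (𝓝 0) := by
  have hRL := Real.tendsto_integral_exp_smul_cocompact
    fun y : ℝ => regularSymbol α (y * Complex.I)
  have harg : Tendsto (fun x : ℝ => -(x / (2 * π))) atTop (cocompact ℝ) :=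
    (tendsto_neg_atTop_atBot.comp (tendsto_id.atTop_div_const (by positivity))).mono_right
      atBot_le_cocompact
  have h := (hRL.comp harg).const_mul ((2 * π : ℂ)⁻¹)
  rw [mul_zero] at h
  refine h.congr' ?_
  filter_upwards [eventually_ge_atTop 0] with x hx
  rw [mittagLefflerRemainder_eq_imaginary hα₀ hα₁ hx, Function.comp_apply]
  push_cast
  congr 1
  refine integral_congr_ae (Eventually.of_forall fun y => ?_)
  simp only [Circle.smul_def, Real.fourierChar_apply, smul_eq_mul]
  congr 2
  push_cast
  field_simp

theorem tendsto_norm_mittagLeffler_rpow {α : ℝ} (hα₀ : 0 < α) (hα₁ : α < 1) :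
    Tendsto (fun x : ℝ => ‖mittagLeffler α 1 (Complex.I ^ (α : ℂ) * ((x ^ α : ℝ) : ℂ))‖)
      atTop (𝓝 (1 / α)) := by
  have hexp : Tendsto (fun x : ℝ => (1 / α - 1 : ℂ) * Complex.exp (-x)) atTop (𝓝 0) := by
    have h : Tendsto (fun x : ℝ => ((Real.exp (-x) : ℝ) : ℂ)) atTop (𝓝 ((0 : ℝ) : ℂ)) :=
      (Complex.continuous_ofReal.tendsto 0).comp Real.tendsto_exp_neg_atTop_nhds_zero
    simpa using h.const_mul (1 / α - 1 : ℂ)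
  have hdiff := (tendsto_mittagLefflerRemainder hα₀ hα₁).sub hexp
  rw [sub_zero] at hdiff
  have hnorm (x : ℝ) : ‖(1 / α * Complex.exp (Complex.I * x) : ℂ)‖ = 1 / α := by
    rw [norm_mul, mul_comm Complex.I, Complex.norm_exp_ofReal_mul_I, norm_div, norm_one,
      Complex.norm_real, Real.norm_of_nonneg hα₀.le, mul_one]
  rw [tendsto_iff_norm_sub_tendsto_zero]
  refine squeeze_zero (fun _ => norm_nonneg _) (fun x => ?_)
    (tendsto_zero_iff_norm_tendsto_zero.1 hdiff)
  rw [← hnorm x, Real.norm_eq_abs]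
  refine (abs_norm_sub_norm_le _ _).trans_eq ?_
  rw [mittagLefflerRemainder]
  congr 1
  ring

/-- For `0 < α < 1` and `r > 0`, `lim_{t→∞} |E_α(r e^{iαπ/2} t^α)| = 1/α`. -/
theorem mittagLeffler_boundary_modulus_limit (α : ℝ) (hα₀ : 0 < α) (hα₁ : α < 1)
    (r : ℝ) (hr : 0 < r) :
    Tendsto
      (fun t : ℝ =>
        ‖mittagLeffler α 1
            ((r : ℂ) * Complex.exp ((α * π / 2 : ℝ) * Complex.I) * ((t ^ α : ℝ) : ℂ))‖)
      atTop (nhds (1 / α)) := by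
  have hlin : Tendsto (fun t : ℝ => r ^ α⁻¹ * t) atTop atTop :=
    tendsto_id.const_mul_atTop (by positivity)
  refine ((tendsto_norm_mittagLeffler_rpow hα₀ hα₁).comp hlin).congr' ?_
  filter_upwards [eventually_ge_atTop 0] with t ht
  have hI : Complex.I ^ (α : ℂ) = Complex.exp ((α * π / 2 : ℝ) * Complex.I) := by
    rw [Complex.cpow_def_of_ne_zero Complex.I_ne_zero, Complex.log_I]
    congr 1
    push_cast
    ring
  rw [Function.comp_apply, Real.mul_rpow (by positivity) ht, Real.rpow_inv_rpow hr.le hα₀.ne', hI]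
  congr 2
  push_cast
  ring
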